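/- arXiv:2502.09521 — 8 statements merged into one kernel-verified Lean document; each statement's English description precedes it below -/
import Mathlib

section
/- Let ρ > 0. For every z ∈ [0,ρ], φ_ρ(z) + ∫₀^z φ_ρ(τ) dτ ≤ 1. -/
/-- The function `φ_ρ` from the paper, defined piecewise on `[0, ρ]`. -/
noncomputable def phi (ρ : ℝ) (z : ℝ) : ℝ :=
  if z ≤ ρ / 2 then (2 * Real.exp (ρ / 2) - Real.exp z) / (1 + Real.exp (ρ / 2) * ρ)
  else Real.exp (ρ - z) / (1 + Real.exp (ρ / 2) * ρ)

open intervalIntegral in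
theorem integral_phi_of_le_half {ρ z : ℝ} (h0 : 0 ≤ z) (hz : z ≤ ρ / 2) :
    ∫ τ in (0:ℝ)..z, phi ρ τ =
      (2 * Real.exp (ρ / 2) * z - (Real.exp z - 1)) / (1 + Real.exp (ρ / 2) * ρ) := by
  have h : Set.EqOn (phi ρ)
      (fun τ => (2 * Real.exp (ρ / 2) - Real.exp τ) / (1 + Real.exp (ρ / 2) * ρ))
      (Set.uIcc 0 z) := by
    intro τ hτ
    rw [Set.uIcc_of_le h0] at hτ
    exact if_pos (hτ.2.trans hz)
  rw [integral_congr h, intervalIntegral.integral_div, integral_sub (by simp) (by simp)]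
  simp [mul_comm z, mul_assoc]

theorem eqOn_phi_of_half_le {ρ z : ℝ} (hz : ρ / 2 ≤ z) :
    Set.EqOn (phi ρ) (fun τ => Real.exp (ρ - τ) / (1 + Real.exp (ρ / 2) * ρ))
      (Set.uIcc (ρ / 2) z) := by
  intro τ hτ
  rw [Set.uIcc_of_le hz] at hτ
  rcases hτ.1.eq_or_lt with rfl | hlt
  · simp only [phi, le_refl, if_true, sub_half]
    ring
  · exact if_neg hlt.not_ge

open intervalIntegral in
theorem integral_phi_of_half_le {ρ z : ℝ} (hz : ρ / 2 ≤ z) :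
    ∫ τ in (ρ / 2)..z, phi ρ τ =
      (Real.exp (ρ / 2) - Real.exp (ρ - z)) / (1 + Real.exp (ρ / 2) * ρ) := by
  rw [integral_congr (eqOn_phi_of_half_le hz), intervalIntegral.integral_div,
    integral_comp_sub_left (fun x => Real.exp x), integral_exp, sub_half]

theorem continuous_phi (ρ : ℝ) : Continuous (phi ρ) := by
  unfold phi
  refine Continuous.if_le (by fun_prop) (by fun_prop) continuous_id continuous_const ?_
  rintro x rfl
  rw [sub_half]
  ring

theorem stmt2 (ρ : ℝ) (hρ : 0 < ρ) :
    ∀ z ∈ Set.Icc (0:ℝ) ρ, phi ρ z + (∫ τ in (0:ℝ)..z, phi ρ τ) ≤ 1 := by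
  rintro z ⟨h0, -⟩
  have hD : 0 < 1 + Real.exp (ρ / 2) * ρ := by positivity
  rcases le_or_gt z (ρ / 2) with hz | hz
  · rw [integral_phi_of_le_half h0 hz, phi, if_pos hz, ← add_div, div_le_one hD]
    have h : Real.exp (ρ / 2) * (z - ρ / 2 + 1) ≤ Real.exp z := by
      calc _ ≤ Real.exp (ρ / 2) * Real.exp (z - ρ / 2) := by
            gcongr
            exact Real.add_one_le_exp _
        _ = Real.exp z := by rw [← Real.exp_add, add_sub_cancel]
    linarith
  · rw [← intervalIntegral.integral_add_adjacent_intervals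
        ((continuous_phi ρ).intervalIntegrable 0 (ρ / 2))
        ((continuous_phi ρ).intervalIntegrable (ρ / 2) z),
      integral_phi_of_le_half (by positivity) le_rfl, integral_phi_of_half_le hz.le, phi,
      if_neg hz.not_ge, ← add_div, ← add_div, div_le_one hD]
    linarith
end

section
/- Fix ρ > 0. For every n ∈ ℕ and every x = (x_1,…,x_n) ∈ [0,1]^n with Σ_{i=1}^n x_i ≤ ρ, there exists a pair (c_f, c_b) that is LP-feasible for (n,x) and satisfies min_{1≤i≤n} (c_f(i)+c_b(i))/2 ≥ α₀(ρ) = exp(ρ/2)/(1 + exp(ρ/2)·ρ). -/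
/-- The constant `α₀(ρ) = exp(ρ/2)/(1 + exp(ρ/2)·ρ)`. -/
noncomputable def alpha0 (ρ : ℝ) : ℝ := Real.exp (ρ / 2) / (1 + Real.exp (ρ / 2) * ρ)

/-- A pair of nonnegative vectors `(cf, cb)` (indexed `0, …, n-1`) is LP-feasible for `(n, x)`
if `cf i + ∑_{j < i} x j · cf j ≤ 1` and `cb i + ∑_{j > i} x j · cb j ≤ 1` for all `i < n`. -/
def LPFeasible (n : ℕ) (x cf cb : ℕ → ℝ) : Prop :=
  (∀ i < n, 0 ≤ cf i) ∧ (∀ i < n, 0 ≤ cb i) ∧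
  (∀ i < n, cf i + ∑ j ∈ Finset.range i, x j * cf j ≤ 1) ∧
  (∀ i < n, cb i + ∑ j ∈ Finset.Ico (i + 1) n, x j * cb j ≤ 1)

/-- The positive decreasing profile `2 - exp s` for `s ≤ 0`, `exp (-s)` for `s > 0`. -/
noncomputable def profile (s : ℝ) : ℝ := if s ≤ 0 then 2 - Real.exp s else Real.exp (-s)

/-- A concave antiderivative of `profile`. -/
noncomputable def profilePrimitive (s : ℝ) : ℝ :=
  if s ≤ 0 then 2 * s - Real.exp s else -Real.exp (-s)

/-- The average of `profile` over `[a, a + h]`, with value `profile a` for `h = 0`. -/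
noncomputable def profileAverage (a h : ℝ) : ℝ :=
  if h = 0 then profile a else (profilePrimitive (a + h) - profilePrimitive a) / h

theorem profile_of_nonpos {s : ℝ} (hs : s ≤ 0) : profile s = 2 - Real.exp s := if_pos hs

theorem profile_of_nonneg {s : ℝ} (hs : 0 ≤ s) : profile s = Real.exp (-s) := by
  rcases hs.eq_or_lt with rfl | hs
  · norm_num [profile]
  · exact if_neg hs.not_ge

theorem profilePrimitive_of_nonpos {s : ℝ} (hs : s ≤ 0) :
    profilePrimitive s = 2 * s - Real.exp s := if_pos hs

theorem profilePrimitive_of_nonneg {s : ℝ} (hs : 0 ≤ s) :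
    profilePrimitive s = -Real.exp (-s) := by
  rcases hs.eq_or_lt with rfl | hs
  · norm_num [profilePrimitive]
  · exact if_neg hs.not_ge

theorem profile_nonneg (s : ℝ) : 0 ≤ profile s := by
  rcases le_total s 0 with h | h
  · rw [profile_of_nonpos h]
    linarith [Real.exp_le_one_iff.2 h]
  · rw [profile_of_nonneg h]
    positivity

theorem profile_add_profile_neg (s : ℝ) : profile s + profile (-s) = 2 := by
  rcases le_total s 0 with h | h
  · rw [profile_of_nonpos h, profile_of_nonneg (neg_nonneg.2 h), neg_neg]
    ring
  · rw [profile_of_nonneg h, profile_of_nonpos (neg_nonpos.2 h)]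
    ring

theorem profilePrimitive_neg (s : ℝ) : profilePrimitive (-s) = profilePrimitive s - 2 * s := by
  rcases le_total s 0 with h | h
  · rw [profilePrimitive_of_nonpos h, profilePrimitive_of_nonneg (neg_nonneg.2 h), neg_neg]
    ring
  · rw [profilePrimitive_of_nonneg h, profilePrimitive_of_nonpos (neg_nonpos.2 h)]
    ring

theorem profile_add_profilePrimitive_nonpos (s : ℝ) : profile s + profilePrimitive s ≤ 0 := by
  rcases le_total s 0 with h | h
  · rw [profile_of_nonpos h, profilePrimitive_of_nonpos h]
    linarith [Real.add_one_le_exp s]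
  · rw [profile_of_nonneg h, profilePrimitive_of_nonneg h]
    linarith

theorem Real.exp_mul_one_add_sub_le (a b : ℝ) : Real.exp a * (1 + (b - a)) ≤ Real.exp b := by
  have h := mul_le_mul_of_nonneg_left (Real.add_one_le_exp (b - a)) (Real.exp_pos a).le
  rw [← Real.exp_add, add_sub_cancel] at h
  linarith

/-- The graph of `profilePrimitive` lies below its tangents. -/
theorem profilePrimitive_le_tangent (a b : ℝ) :
    profilePrimitive b ≤ profilePrimitive a + profile a * (b - a) := by
  have neg : ∀ a b : ℝ, a ≤ 0 → b ≤ 0 →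
      profilePrimitive b ≤ profilePrimitive a + profile a * (b - a) := fun a b ha hb ↦ by
    rw [profilePrimitive_of_nonpos ha, profilePrimitive_of_nonpos hb, profile_of_nonpos ha]
    linarith [Real.exp_mul_one_add_sub_le a b]
  have pos : ∀ a b : ℝ, 0 ≤ a → 0 ≤ b →
      profilePrimitive b ≤ profilePrimitive a + profile a * (b - a) := fun a b ha hb ↦ by
    rw [profilePrimitive_of_nonneg ha, profilePrimitive_of_nonneg hb, profile_of_nonneg ha]
    linarith [Real.exp_mul_one_add_sub_le (-a) (-b)]
  have zero : profile 0 = 1 := by norm_num [profile]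
  rcases le_total a 0 with ha | ha <;> rcases le_total b 0 with hb | hb
  · exact neg a b ha hb
  · have h1 := neg a 0 ha le_rfl
    have h2 := pos 0 b le_rfl hb
    have h3 : 1 ≤ profile a := by
      rw [profile_of_nonpos ha]
      linarith [Real.exp_le_one_iff.2 ha]
    rw [zero] at h2
    nlinarith
  · have h1 := pos a 0 ha le_rfl
    have h2 := neg 0 b le_rfl hb
    have h3 : profile a ≤ 1 := by
      rw [profile_of_nonneg ha]
      exact Real.exp_le_one_iff.2 (neg_nonpos.2 ha)
    rw [zero] at h2
    nlinarith
  · exact pos a b ha hb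

theorem profilePrimitive_monotone : Monotone profilePrimitive := fun a b hab ↦ by
  have := profilePrimitive_le_tangent b a
  nlinarith [mul_nonneg (profile_nonneg b) (sub_nonneg.2 hab)]

theorem mul_profileAverage (a h : ℝ) :
    h * profileAverage a h = profilePrimitive (a + h) - profilePrimitive a := by
  unfold profileAverage
  split_ifs with h0
  · simp [h0]
  · field_simp

theorem profileAverage_le (a : ℝ) {h : ℝ} (hh : 0 ≤ h) : profileAverage a h ≤ profile a := by
  unfold profileAverage
  split_ifs with h0
  · exact le_rfl
  · rw [div_le_iff₀ (lt_of_le_of_ne hh (Ne.symm h0))]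
    linarith [profilePrimitive_le_tangent a (a + h)]

theorem le_profileAverage (a : ℝ) {h : ℝ} (hh : 0 ≤ h) :
    profile (a + h) ≤ profileAverage a h := by
  unfold profileAverage
  split_ifs with h0
  · simp [h0]
  · rw [le_div_iff₀ (lt_of_le_of_ne hh (Ne.symm h0))]
    linarith [profilePrimitive_le_tangent (a + h) a]

theorem alpha0_pos {ρ : ℝ} (hρ : 0 < ρ) : 0 < alpha0 ρ := by
  unfold alpha0
  positivity

theorem alpha0_mul_profilePrimitive {ρ : ℝ} (hρ : 0 < ρ) :
    alpha0 ρ * profilePrimitive (-(ρ / 2)) = -1 := by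
  rw [profilePrimitive_of_nonpos (by linarith), alpha0, Real.exp_neg]
  have : 1 + Real.exp (ρ / 2) * ρ ≠ 0 := by positivity
  field_simp
  ring

theorem stmt5 (ρ : ℝ) (hρ : 0 < ρ) (n : ℕ) (x : ℕ → ℝ)
    (hx : ∀ i < n, x i ∈ Set.Icc (0:ℝ) 1)
    (hsum : ∑ i ∈ Finset.range n, x i ≤ ρ) :
    ∃ cf cb : ℕ → ℝ, LPFeasible n x cf cb ∧
      ∀ i < n, alpha0 ρ ≤ (cf i + cb i) / 2 := by
  have hα := alpha0_pos hρ
  have hF := alpha0_mul_profilePrimitive hρ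
  set α := alpha0 ρ
  let a : ℕ → ℝ := fun i ↦ ∑ j ∈ Finset.range i, x j - ρ / 2
  have ha0 : a 0 = -(ρ / 2) := by simp [a]
  have ha (i : ℕ) : a (i + 1) = a i + x i := by
    simp only [a, Finset.sum_range_succ]
    ring
  let m : ℕ → ℝ := fun i ↦ profileAverage (a i) (x i)
  have hm (i : ℕ) : x i * m i = profilePrimitive (a (i + 1)) - profilePrimitive (a i) := by
    rw [ha]
    exact mul_profileAverage _ _
  have hm_le (i : ℕ) (hi : i < n) : m i ≤ profile (a i) := profileAverage_le _ (hx i hi).1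
  have hm_ge (i : ℕ) (hi : i < n) : 2 - m i ≤ profile (-a (i + 1)) := by
    have := le_profileAverage (a i) (hx i hi).1
    rw [← ha] at this
    linarith [profile_add_profile_neg (a (i + 1))]
  refine ⟨fun i ↦ α * m i, fun i ↦ α * (2 - m i), ⟨fun i hi ↦ ?_, fun i hi ↦ ?_, fun i hi ↦ ?_,
    fun i hi ↦ ?_⟩, fun i _ ↦ le_of_eq (by ring)⟩
  · exact mul_nonneg hα.le ((profile_nonneg _).trans (le_profileAverage _ (hx i hi).1))
  · refine mul_nonneg hα.le ?_
    linarith [hm_le i hi, profile_add_profile_neg (a i), profile_nonneg (-a i)]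
  · have hs : ∑ j ∈ Finset.range i, x j * (α * m j)
        = α * (profilePrimitive (a i) - profilePrimitive (a 0)) := by
      rw [← Finset.sum_range_sub (fun j ↦ profilePrimitive (a j)), Finset.mul_sum]
      exact Finset.sum_congr rfl fun j _ ↦ by rw [← hm]; ring
    rw [hs, ha0]
    have := mul_le_mul_of_nonneg_left ((add_le_add_left (hm_le i hi) _).trans
      (profile_add_profilePrimitive_nonpos (a i))) hα.le
    linarith
  · have hs : ∑ j ∈ Finset.Ico (i + 1) n, x j * (α * (2 - m j))
        = α * (profilePrimitive (-a (i + 1)) - profilePrimitive (-a n)) := by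
      rw [← neg_sub, ← Finset.sum_Ico_sub (fun j ↦ profilePrimitive (-a j)) hi,
        ← Finset.sum_neg_distrib, Finset.mul_sum]
      refine Finset.sum_congr rfl fun j _ ↦ ?_
      rw [profilePrimitive_neg, profilePrimitive_neg]
      linear_combination -α * hm j - 2 * α * ha j
    have han : -(ρ / 2) ≤ -a n := by
      simp only [a]
      linarith
    have h1 := mul_le_mul_of_nonneg_left (profilePrimitive_monotone han) hα.le
    have h2 := mul_le_mul_of_nonneg_left ((add_le_add_left (hm_ge i hi) _).trans
      (profile_add_profilePrimitive_nonpos (-a (i + 1)))) hα.le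
    rw [hs]
    linarith
end

section
/- Let ρ > 0. For every z ∈ [ρ/2, ρ], γ_ρ(z) + ∫_z^ρ γ_ρ(τ) dτ = ρ·α₀(ρ)/2, where α₀(ρ) := exp(ρ/2)/(1 + exp(ρ/2)·ρ). -/
/-- The function `γ_ρ` from the paper, on `[ρ/2, ρ]`. -/
noncomputable def gammaFn (ρ : ℝ) (z : ℝ) : ℝ :=
  ρ * Real.exp (z - ρ / 2) / (2 * (1 + Real.exp (ρ / 2) * ρ))

/-- The function `γ_ρ` is its own derivative. -/
lemma hasDerivAt_gammaFn (ρ z : ℝ) : HasDerivAt (gammaFn ρ) (gammaFn ρ z) z := by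
  have h := (((hasDerivAt_id z).sub_const (ρ / 2)).exp.const_mul ρ).div_const
    (2 * (1 + Real.exp (ρ / 2) * ρ))
  rw [id, mul_one] at h
  exact h

lemma integral_gammaFn (ρ a b : ℝ) :
    ∫ τ in a..b, gammaFn ρ τ = gammaFn ρ b - gammaFn ρ a := by
  have hc : Continuous (gammaFn ρ) :=
    continuous_iff_continuousAt.2 fun z => (hasDerivAt_gammaFn ρ z).continuousAt
  exact intervalIntegral.integral_eq_sub_of_hasDerivAt
    (fun z _ => hasDerivAt_gammaFn ρ z) (hc.intervalIntegrable a b)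

lemma gammaFn_self (ρ : ℝ) : gammaFn ρ ρ = ρ * alpha0 ρ / 2 := by
  rw [gammaFn, alpha0, sub_half, mul_comm 2, ← div_div, mul_div_assoc]

theorem stmt7 (ρ : ℝ) (hρ : 0 < ρ) :
    ∀ z ∈ Set.Icc (ρ / 2) ρ,
      gammaFn ρ z + (∫ τ in z..ρ, gammaFn ρ τ) = ρ * alpha0 ρ / 2 := by
  intro z _
  rw [integral_gammaFn, add_sub_cancel, gammaFn_self]
end

section
/- Fix ρ ≥ 0, n ≥ 0, and N = 2n+1, and let x_i = ρ/N for all i ∈ {1,…,N} (assume ρ/N ≤ 1 so that each x_i is a probability). Then every pair (c_f, c_b) that is LP-feasible for (N,x) satisfies min_{1≤i≤N} (c_f(i)+c_b(i))/2 ≤ α₀(ρ) + (ρ+2)/N, where α₀(ρ) := exp(ρ/2)/(1 + exp(ρ/2)·ρ). -/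
open Finset in
/-- If every entry is bounded by one minus `h` times the preceding partial sum, the slack of the
partial sums decays at most geometrically with ratio `1 - h`. -/
theorem pow_mul_slack_le {h : ℝ} (h0 : 0 ≤ h) {N : ℕ} {c : ℕ → ℝ}
    (hc : ∀ i < N, c i + h * ∑ j ∈ range i, c j ≤ 1) (h1 : h ≤ 1) (m k : ℕ) (hk : m + k ≤ N) :
    (1 - h) ^ k * (1 - h * ∑ j ∈ range m, c j) ≤ 1 - h * ∑ j ∈ range (m + k), c j := by
  induction k with
  | zero => simp
  | succ k ih =>
    have hstep := mul_le_mul_of_nonneg_left (ih (by omega)) (sub_nonneg.2 h1)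
    have hbound := mul_le_mul_of_nonneg_left (hc (m + k) (by omega)) h0
    rw [← add_assoc, sum_range_succ, pow_succ]
    linarith

open Finset in
theorem pow_mul_entry_le {h : ℝ} (h0 : 0 ≤ h) {N : ℕ} {c : ℕ → ℝ}
    (hc : ∀ i < N, c i + h * ∑ j ∈ range i, c j ≤ 1) (h1 : h ≤ 1) {m k : ℕ} (hk : m + k = N)
    (hm : m < N) : (1 - h) ^ k * c m ≤ 1 - h * ∑ j ∈ range N, c j := by
  subst hk
  exact (mul_le_mul_of_nonneg_left (by linarith [hc m hm]) (pow_nonneg (sub_nonneg.2 h1) k)).trans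
    (pow_mul_slack_le h0 hc h1 m k le_rfl)

theorem pow_sub_pow_le_mul_sub {x y : ℝ} (hy : 0 ≤ y) (hyx : y ≤ x) (hx : x ≤ 1) (n : ℕ) :
    x ^ n - y ^ n ≤ n * (x - y) := by
  induction n with
  | zero => simp
  | succ n ih =>
    have hxn : x ^ n ≤ 1 := pow_le_one₀ (hy.trans hyx) hx
    have hdiff : 0 ≤ x ^ n - y ^ n := sub_nonneg.2 (pow_le_pow_left₀ hy hyx n)
    have h₁ := mul_le_mul_of_nonneg_right hxn (sub_nonneg.2 hyx)
    have h₂ := mul_le_mul_of_nonneg_left (hyx.trans hx) hdiff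
    push_cast
    rw [pow_succ, pow_succ]
    linarith

theorem exp_neg_sub_one_sub_le_sq {h : ℝ} (h0 : 0 ≤ h) : Real.exp (-h) - (1 - h) ≤ h ^ 2 := by
  have hinv : Real.exp (-h) * Real.exp h = 1 := by rw [← Real.exp_add]; simp
  have hmul := mul_le_mul_of_nonneg_left (Real.add_one_le_exp h) (Real.exp_pos (-h)).le
  nlinarith [pow_nonneg h0 3]

theorem exp_neg_sub_pow_le {h : ℝ} (h0 : 0 ≤ h) (h1 : h ≤ 1) (n : ℕ) :
    Real.exp (-(h * (2 * n + 1) / 2)) - (1 - h) ^ (n + 1) ≤ n * h ^ 2 + h := by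
  have hexp : Real.exp (-(h * (2 * n + 1) / 2)) ≤ Real.exp (-h) ^ n := by
    rw [← Real.exp_nat_mul]
    exact Real.exp_le_exp.2 (by linarith)
  have hpow := pow_sub_pow_le_mul_sub (sub_nonneg.2 h1) (Real.one_sub_le_exp_neg h)
    (Real.exp_le_one_iff.2 (neg_nonpos.2 h0)) n
  have hsq := mul_le_mul_of_nonneg_left (exp_neg_sub_one_sub_le_sq h0) n.cast_nonneg (α := ℝ)
  have hone : (1 - h) ^ n ≤ 1 := pow_le_one₀ (sub_nonneg.2 h1) (by linarith)
  have hlast := mul_le_mul_of_nonneg_right hone h0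
  rw [pow_succ]
  linarith

theorem alpha0_mul_exp_neg_add {ρ : ℝ} (hρ : 0 ≤ ρ) :
    alpha0 ρ * (Real.exp (-(ρ / 2)) + ρ) = 1 := by
  have hexp := Real.exp_pos (ρ / 2)
  rw [alpha0, Real.exp_neg]
  field_simp

theorem stmt9 (ρ : ℝ) (hρ : 0 ≤ ρ) (n : ℕ) :
    let N : ℕ := 2 * n + 1
    ρ / (N : ℝ) ≤ 1 →
    ∀ cf cb : ℕ → ℝ, LPFeasible N (fun _ => ρ / (N : ℝ)) cf cb →
      ∃ i < N, (cf i + cb i) / 2 ≤ alpha0 ρ + (ρ + 2) / (N : ℝ) := by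
  intro N hN cf cb hc
  obtain ⟨-, -, hf, hb⟩ := hc
  by_contra! hcon
  have hNcast : (N : ℝ) = 2 * n + 1 := by simp [N]
  have hNpos : (0 : ℝ) < N := by rw [hNcast]; positivity
  set h : ℝ := ρ / N
  have h0 : 0 ≤ h := by positivity
  have hρN : h * N = ρ := div_mul_cancel₀ _ hNpos.ne'
  have hforward : ∀ i < N, cf i + h * ∑ j ∈ Finset.range i, cf j ≤ 1 := by
    simpa only [Finset.mul_sum] using hf
  have hbackward : ∀ i < N, cb (N - 1 - i) + h * ∑ j ∈ Finset.range i, cb (N - 1 - j) ≤ 1 := by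
    intro i hi
    convert hb (N - 1 - i) (by omega) using 2
    rw [← Finset.mul_sum, Finset.range_eq_Ico, Finset.sum_Ico_reflect cb 0 (by omega)]
    congr 3
    all_goals omega
  have hmid_f := pow_mul_entry_le h0 hforward hN (m := n) (k := n + 1) (by omega) (by omega)
  have hmid_b := pow_mul_entry_le h0 hbackward hN (m := n) (k := n + 1) (by omega) (by omega)
  rw [Finset.sum_range_reflect cb N, show N - 1 - n = n by omega] at hmid_b
  set A := alpha0 ρ + (ρ + 2) / N with hA
  set p := (1 - h) ^ (n + 1) with hp
  have hp0 : 0 ≤ p := pow_nonneg (sub_nonneg.2 hN) _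
  have hsum : (N : ℝ) * (2 * A) ≤ ∑ j ∈ Finset.range N, cf j + ∑ j ∈ Finset.range N, cb j := by
    rw [← Finset.sum_add_distrib]
    simpa using Finset.card_nsmul_le_sum (Finset.range N) (fun j => cf j + cb j) (2 * A)
      fun j hj => by linarith [hcon j (Finset.mem_range.1 hj)]
  have hA_le : A * (p + ρ) ≤ 1 := by
    have h₁ := mul_le_mul_of_nonneg_left hsum h0
    have h₂ := mul_le_mul_of_nonneg_left (hcon n (by omega)).le hp0
    have h₃ : h * (N * (2 * A)) = 2 * (A * ρ) := by rw [← hρN]; ring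
    linarith
  have hp_add : 1 ≤ p + ρ := by
    have hbern := one_add_mul_le_pow (a := -h) (by linarith) (n + 1)
    have hnh : 0 ≤ n * h := by positivity
    rw [← sub_eq_add_neg, ← hp] at hbern
    rw [← hρN, hNcast]
    push_cast at hbern
    linarith
  have halpha := alpha0_mul_exp_neg_add hρ
  have hgap := exp_neg_sub_pow_le h0 hN n
  rw [← hNcast, hρN, ← hp] at hgap
  set e := Real.exp (-(ρ / 2))
  have he_add : 1 + ρ / 2 ≤ e + ρ := by linarith [Real.one_sub_le_exp_neg (ρ / 2)]
  have halpha_pos : 0 < alpha0 ρ := by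
    by_contra! hle
    nlinarith
  have halpha_le : alpha0 ρ * (1 + ρ / 2) ≤ 1 :=
    (mul_le_mul_of_nonneg_left he_add halpha_pos.le).trans halpha.le
  have hgap' : e - p ≤ h * (1 + ρ / 2) := by
    have h₁ : h * ρ = h * (h * (2 * n + 1)) := by rw [← hNcast, hρN]
    nlinarith [sq_nonneg h]
  have hgap_alpha : alpha0 ρ * (e - p) ≤ h := by
    have h₁ := mul_le_mul_of_nonneg_left hgap' halpha_pos.le
    have h₂ := mul_le_mul_of_nonneg_left halpha_le h0
    linarith
  have herror : h < (ρ + 2) / N := div_lt_div_of_pos_right (by linarith) hNpos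
  have herror_mul := mul_le_mul_of_nonneg_left hp_add (h0.trans herror.le)
  rw [hA] at hA_le
  linarith
end

section
/- (Splitting argument.) Let n ∈ ℕ, x = (x_1,…,x_n) ∈ [0,1]^n, and k ∈ {1,…,n}. Define x̃ ∈ [0,1]^{n+1} by x̃_i = x_i for i < k, x̃_k = x̃_{k+1} = x_k/2, and x̃_i = x_{i−1} for k+1 < i ≤ n+1. Then Σ_{i=1}^{n+1} x̃_i = Σ_{i=1}^n x_i, and for every pair (c̃_f, c̃_b) that is LP-feasible for (n+1, x̃), there exists a pair (c_f, c_b) that is LP-feasible for (n, x) with min_{1≤i≤n} (c_f(i)+c_b(i))/2 ≥ min_{1≤i≤n+1} (c̃_f(i)+c̃_b(i))/2. -/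
/-- Merging the adjacent terms `k` and `k + 1` of a sequence: sums ending before the merged term. -/
theorem sum_range_merge_of_le {k : ℕ} {g g' : ℕ → ℝ} (hlt : ∀ i < k, g i = g' i)
    {i : ℕ} (hi : i ≤ k) : ∑ j ∈ Finset.range i, g j = ∑ j ∈ Finset.range i, g' j :=
  Finset.sum_congr rfl fun j hj => hlt j (by have := Finset.mem_range.1 hj; omega)

/-- Merging the adjacent terms `k` and `k + 1` of a sequence: sums including the merged term. -/
theorem sum_range_merge_of_lt {k : ℕ} {g g' : ℕ → ℝ} (hlt : ∀ i < k, g i = g' i)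
    (heq : g k = g' k + g' (k + 1)) (hgt : ∀ i, k < i → g i = g' (i + 1))
    {i : ℕ} (hi : k < i) :
    ∑ j ∈ Finset.range i, g j = ∑ j ∈ Finset.range (i + 1), g' j := by
  induction i, hi using Nat.le_induction with
  | base =>
    rw [Finset.sum_range_succ, sum_range_merge_of_le hlt le_rfl, heq, Finset.sum_range_succ,
      Finset.sum_range_succ, add_assoc]
  | succ i hi ih => rw [Finset.sum_range_succ, ih, hgt i hi, ← Finset.sum_range_succ]

/-- The splitting argument: splitting element `k` (0-indexed) into two halves does not
increase the optimal LP value. -/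
theorem stmt10 (n : ℕ) (x : ℕ → ℝ) (hx : ∀ i < n, x i ∈ Set.Icc (0:ℝ) 1)
    (k : ℕ) (hk : k < n) :
    let x' : ℕ → ℝ := fun i => if i < k then x i else if i ≤ k + 1 then x k / 2 else x (i - 1)
    (∑ i ∈ Finset.range (n + 1), x' i = ∑ i ∈ Finset.range n, x i) ∧
    ∀ cf' cb' : ℕ → ℝ, LPFeasible (n + 1) x' cf' cb' →
      ∃ cf cb : ℕ → ℝ, LPFeasible n x cf cb ∧
        sInf {v : ℝ | ∃ i < n + 1, v = (cf' i + cb' i) / 2} ≤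
          sInf {v : ℝ | ∃ i < n, v = (cf i + cb i) / 2} := by
  intro x'
  have x'_lt : ∀ i < k, x' i = x i := fun i hi => by simp [x', hi]
  have x'_k : x' k = x k / 2 := by simp [x']
  have x'_k1 : x' (k + 1) = x k / 2 := by simp [x']
  have x'_gt : ∀ i, k < i → x' (i + 1) = x i := fun i hi => by
    simp [x', show ¬ i + 1 < k by omega, show ¬ i ≤ k by omega]
  refine ⟨(sum_range_merge_of_lt (fun i hi => (x'_lt i hi).symm) (by rw [x'_k, x'_k1]; ring)
    (fun i hi => (x'_gt i hi).symm) hk).symm, ?_⟩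
  rintro f' b' ⟨hf0, hb0, hf, hb⟩
  have hxk := (hx k hk).1
  let merge (c : ℕ → ℝ) (i : ℕ) : ℝ :=
    if i < k then c i else if i = k then (c k + c (k + 1)) / 2 else c (i + 1)
  have m_lt : ∀ c, ∀ i < k, merge c i = c i := fun c i hi => by simp [merge, hi]
  have m_k : ∀ c, merge c k = (c k + c (k + 1)) / 2 := fun c => by simp [merge]
  have m_gt : ∀ c i, k < i → merge c i = c (i + 1) := fun c i hi => by
    simp [merge, show ¬ i < k by omega, show i ≠ k by omega]
  have g_lt : ∀ c, ∀ i < k, x i * merge c i = x' i * c i := fun c i hi => by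
    rw [m_lt c i hi, x'_lt i hi]
  have g_k : ∀ c, x k * merge c k = x' k * c k + x' (k + 1) * c (k + 1) := fun c => by
    rw [m_k, x'_k, x'_k1]; ring
  have g_gt : ∀ c i, k < i → x i * merge c i = x' (i + 1) * c (i + 1) := fun c i hi => by
    rw [m_gt c i hi, x'_gt i hi]
  have s_le (c : ℕ → ℝ) {i : ℕ} (hi : i ≤ k) := sum_range_merge_of_le (g_lt c) hi
  have s_lt (c : ℕ → ℝ) {i : ℕ} (hi : k < i) :=
    sum_range_merge_of_lt (g_lt c) (g_k c) (g_gt c) hi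
  have m_nonneg : ∀ c : ℕ → ℝ, (∀ i < n + 1, 0 ≤ c i) → ∀ i < n, 0 ≤ merge c i := by
    intro c hc i hi
    rcases lt_trichotomy i k with h | rfl | h
    · rw [m_lt c i h]; exact hc i (by omega)
    · rw [m_k]; linarith [hc i (by omega), hc (i + 1) (by omega)]
    · rw [m_gt c i h]; exact hc _ (by omega)
  refine ⟨merge f', merge b', ⟨m_nonneg f' hf0, m_nonneg b' hb0, fun i hi => ?_,
    fun i hi => ?_⟩, ?_⟩
  · rcases lt_trichotomy i k with h | rfl | h
    · rw [s_le f' h.le, m_lt f' i h]; exact hf i (by omega)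
    · rw [s_le f' le_rfl, m_k]
      have h1 := hf i (by omega)
      have h2 := hf (i + 1) (by omega)
      rw [Finset.sum_range_succ, x'_k] at h2
      linarith [mul_nonneg hxk (hf0 i (by omega))]
    · rw [s_lt f' h, m_gt f' i h]; exact hf _ (by omega)
  · rw [Finset.sum_Ico_eq_sub _ (by omega : i + 1 ≤ n), s_lt b' hk]
    rcases lt_trichotomy i k with h | rfl | h
    · rw [s_le b' h, m_lt b' i h, ← Finset.sum_Ico_eq_sub _ (by omega)]
      exact hb i (by omega)
    · rw [s_lt b' (Nat.lt_succ_self _), m_k]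
      have h1 := hb i (by omega)
      have h2 := hb (i + 1) (by omega)
      rw [Finset.sum_Ico_eq_sub _ (by omega)] at h1 h2
      rw [Finset.sum_range_succ _ (i + 1), x'_k1] at h2 ⊢
      linarith [mul_nonneg hxk (hb0 (i + 1) (by omega))]
    · rw [s_lt b' (by omega : k < i + 1), m_gt b' i h, ← Finset.sum_Ico_eq_sub _ (by omega)]
      exact hb _ (by omega)
  · have bdd : BddBelow {v : ℝ | ∃ i < n + 1, v = (f' i + b' i) / 2} :=
      ⟨0, by rintro _ ⟨i, hi, rfl⟩; linarith [hf0 i hi, hb0 i hi]⟩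
    have le_val : ∀ i < n + 1,
        sInf {v : ℝ | ∃ i < n + 1, v = (f' i + b' i) / 2} ≤ (f' i + b' i) / 2 :=
      fun i hi => csInf_le bdd ⟨i, hi, rfl⟩
    refine le_csInf ⟨_, k, hk, rfl⟩ ?_
    rintro _ ⟨i, hi, rfl⟩
    rcases lt_trichotomy i k with h | rfl | h
    · rw [m_lt _ i h, m_lt _ i h]; exact le_val i (by omega)
    · rw [m_k, m_k]; linarith [le_val i (by omega), le_val (i + 1) (by omega)]
    · rw [m_gt _ i h, m_gt _ i h]; exact le_val _ (by omega)
end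

section
/- Define ψ : [0,1] → ℝ by ψ(z) = 4/9 − 2z/9. Then for every z ∈ [0,1]: ψ(z) ≤ 1 − 2·∫₀^z ψ(τ) dτ − ψ(0)·exp(−(2/ψ(0))·∫₀^z ψ(τ) dτ); equivalently, 4/9 − 2z/9 ≤ 1 − 2·(4z/9 − z²/9) − (4/9)·exp(−(9/2)·(4z/9 − z²/9)). -/
/-- The function `ψ(z) = 4/9 − 2z/9` used for the knapsack FB-CRS. -/
noncomputable def psi (z : ℝ) : ℝ := 4 / 9 - 2 * z / 9

theorem integral_psi (z : ℝ) : ∫ τ in (0:ℝ)..z, psi τ = 4 * z / 9 - z ^ 2 / 9 := by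
  have h : ∀ x ∈ Set.uIcc 0 z, HasDerivAt (fun t : ℝ => 4 * t / 9 - t ^ 2 / 9) (psi x) x := by
    intro x _
    have h1 := (((hasDerivAt_id x).const_mul 4).div_const 9).sub
      (((hasDerivAt_id x).pow 2).div_const 9)
    refine h1.congr_deriv ?_
    simp only [psi, id]
    ring
  rw [intervalIntegral.integral_eq_sub_of_hasDerivAt h
    (by unfold psi; exact (by fun_prop : Continuous _).intervalIntegrable _ _)]
  ring

theorem cubic_taylor_le_exp {u : ℝ} (hu : 0 ≤ u) :
    1 + u + u ^ 2 / 2 + u ^ 3 / 6 ≤ Real.exp u := by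
  have h := Real.sum_le_exp_of_nonneg hu 4
  norm_num [Finset.sum_range_succ, Nat.factorial] at h
  exact h

/-- With `v = 3/2 - u`, the difference of `(1 + 2v)` times the cubic Taylor polynomial of `exp`
at `u` and `4` factors as `u` times a cubic that is nonnegative on `[0, 3/2]`. -/
theorem four_mul_exp_neg_le {u : ℝ} (hu : 0 ≤ u) (hu' : u ≤ 3 / 2) :
    4 * Real.exp (-u) ≤ 1 + 2 * (3 / 2 - u) := by
  rw [Real.exp_neg, ← div_eq_mul_inv, div_le_iff₀ (Real.exp_pos u)]
  obtain ⟨v, rfl⟩ : ∃ v, u = 3 / 2 - v := ⟨3 / 2 - u, by ring⟩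
  have hv : 0 ≤ v := by linarith
  have hT := mul_le_mul_of_nonneg_left (cubic_taylor_le_exp hu)
    (by linarith : (0:ℝ) ≤ 1 + 2 * v)
  have hc : 0 ≤ 1 / 8 + 13 / 4 * v - 11 / 6 * v ^ 2 + 1 / 3 * v ^ 3 := by
    nlinarith [mul_nonneg hv hu, pow_nonneg hv 3]
  have hp := mul_nonneg hu hc
  rw [sub_sub_cancel]
  linarith

theorem stmt12 :
    ∀ z ∈ Set.Icc (0:ℝ) 1,
      psi z ≤ 1 - 2 * (∫ τ in (0:ℝ)..z, psi τ) -
        psi 0 * Real.exp (-(2 / psi 0) * ∫ τ in (0:ℝ)..z, psi τ) := by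
  rintro z ⟨h0, h1⟩
  have h := four_mul_exp_neg_le (u := 2 * z - z ^ 2 / 2) (by nlinarith) (by nlinarith)
  have he : -(2 / psi 0) * (4 * z / 9 - z ^ 2 / 9) = -(2 * z - z ^ 2 / 2) := by
    norm_num [psi]
    ring
  rw [integral_psi, he]
  norm_num only [psi]
  nlinarith [sq_nonneg (1 - z)]
end

section
/- Let n ∈ ℕ and μ = (μ_1,…,μ_n) with μ_i > 0 for all i and Σ_{i=1}^n μ_i = 1. Define μ_f(i) := Σ_{j<i} μ_j and μ_b(i) := Σ_{j>i} μ_j, and with ψ(z) = 4/9 − 2z/9 set c_f(i) := (1/μ_i)·∫_{μ_f(i)}^{μ_f(i)+μ_i} ψ(τ) dτ and c_b(i) := (1/μ_i)·∫_{μ_b(i)}^{μ_b(i)+μ_i} ψ(τ) dτ. Then (c_f, c_b) is knapsack-feasible for (n, μ), and (c_f(i) + c_b(i))/2 = 1/3 for every i ∈ {1,…,n}; in particular min_{1≤i≤n} (c_f(i)+c_b(i))/2 = 1/3. -/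
/-- A pair of vectors `(cf, cb)` in `[0,1]^n` (indexed `0, …, n-1`) is knapsack-feasible
for `(n, μ)`: `cf` is nonincreasing and `cb` is nondecreasing, and both the linear and the
exponential feasibility constraints of Definition `knapsack_feasible` hold. -/
noncomputable def KnapsackFeasible (n : ℕ) (μ cf cb : ℕ → ℝ) : Prop :=
  (∀ i < n, cf i ∈ Set.Icc (0:ℝ) 1 ∧ cb i ∈ Set.Icc (0:ℝ) 1) ∧
  (∀ i, i + 1 < n → cf (i + 1) ≤ cf i ∧ cb i ≤ cb (i + 1)) ∧
  (∀ i < n, cf i ≤ 1 - cf 0 - ∑ j ∈ Finset.range i, cf j * μ j) ∧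
  (∀ i < n, cb i ≤ 1 - cb (n - 1) - ∑ j ∈ Finset.Ico (i + 1) n, cb j * μ j) ∧
  (∀ i < n, cf i ≤ 1 - 2 * ∑ j ∈ Finset.range i, cf j * μ j -
      cf 0 * Real.exp (-(2 / cf 0) * ∑ j ∈ Finset.range i, cf j * μ j)) ∧
  (∀ i < n, cb i ≤ 1 - 2 * ∑ j ∈ Finset.Ico (i + 1) n, cb j * μ j -
      cb (n - 1) * Real.exp (-(2 / cb (n - 1)) * ∑ j ∈ Finset.Ico (i + 1) n, cb j * μ j))

theorem average_psi (s m : ℝ) (hm : 0 < m) :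
    (1 / m) * ∫ τ in s..(s + m), psi τ = 4 / 9 - (2 * s + m) / 9 := by
  have h : ∫ τ in s..(s + m), psi τ = m * (4 / 9 - (2 * s + m) / 9) := by
    have hderiv : ∀ x ∈ Set.uIcc s (s + m),
        HasDerivAt (fun z : ℝ => 4 / 9 * z - z ^ 2 / 9) (psi x) x := by
      intro x _
      refine (((hasDerivAt_id' x).const_mul (4 / 9 : ℝ)).sub
        ((hasDerivAt_pow 2 x).div_const 9)).congr_deriv ?_
      simp [psi]
    have hcont : Continuous psi := by
      unfold psi
      fun_prop
    rw [intervalIntegral.integral_eq_sub_of_hasDerivAt hderiv (hcont.intervalIntegrable _ _)]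
    ring
  rw [h]
  field_simp

theorem mul_exp_neg_div_le {c d a : ℝ} (hc : 0 < c) (hcd : c ≤ d) (ha : 0 ≤ a) :
    c * Real.exp (-(a / c)) ≤ d * Real.exp (-(a / d)) := by
  have hd : 0 < d := hc.trans_le hcd
  have h : a / d ≤ a / c := by gcongr
  gcongr

theorem four_mul_exp_le {s : ℝ} (hs0 : 0 ≤ s) (hs1 : s ≤ 1) :
    4 * Real.exp (-(2 * s - s ^ 2 / 2)) ≤ 5 - 6 * s + 2 * s ^ 2 := by
  have hx0 : 0 ≤ 2 * s - s ^ 2 / 2 := by nlinarith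
  set x := 2 * s - s ^ 2 / 2 with hx
  have hT : 1 + x + x ^ 2 / 2 + x ^ 3 / 6 ≤ Real.exp x := by
    have h := Real.sum_le_exp_of_nonneg hx0 4
    simpa [Finset.sum_range_succ, Nat.factorial] using h
  have hp : 0 < 5 - 6 * s + 2 * s ^ 2 := by nlinarith [sq_nonneg (s - 3 / 2)]
  have key : 4 ≤ (5 - 6 * s + 2 * s ^ 2) * Real.exp x := by
    rcases le_total s (3 / 5) with h | h
    · have hl : 1 + x ≤ Real.exp x := by linarith [Real.add_one_le_exp x]
      refine le_trans ?_ (mul_le_mul_of_nonneg_left hl hp.le)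
      rw [hx]
      nlinarith [mul_nonneg hs0 (sub_nonneg.2 h), sq_nonneg (s * (s - 3 / 5)),
        mul_nonneg hs0 (mul_nonneg hs0 (sub_nonneg.2 h)), sq_nonneg (s - 1 / 2)]
    · have hl : 67 / 16 + 29 / 8 * (x - 3 / 2) ≤ Real.exp x := by
        refine le_trans ?_ hT
        nlinarith [mul_nonneg (by linarith : 0 ≤ x + 6) (sq_nonneg (x - 3 / 2))]
      refine le_trans ?_ (mul_le_mul_of_nonneg_left hl hp.le)
      rw [hx]
      obtain ⟨u, rfl⟩ : ∃ u, s = 1 - u := ⟨1 - s, by ring⟩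
      have hu0 : 0 ≤ u := by linarith
      have hu1 : 0 ≤ 2 / 5 - u := by linarith
      nlinarith [mul_nonneg hu0 hu1, mul_nonneg hu0 (mul_nonneg hu0 hu1),
        mul_nonneg hu0 (mul_nonneg hu0 (mul_nonneg hu0 hu1))]
  rw [Real.exp_neg, ← div_eq_mul_inv, div_le_iff₀ (Real.exp_pos x)]
  exact key

theorem linear_constraint {s m m₀ : ℝ} (hm : 0 ≤ m) (hm₀ : 0 ≤ m₀) :
    4 / 9 - (2 * s + m) / 9 ≤ 1 - (4 / 9 - m₀ / 9) - (4 * s / 9 - s ^ 2 / 9) := by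
  nlinarith [sq_nonneg (s - 1)]

theorem exponential_constraint {s m m₀ : ℝ} (hs0 : 0 ≤ s) (hs1 : s ≤ 1) (hm : 0 ≤ m)
    (hm₀ : 0 ≤ m₀) (hm₀1 : m₀ ≤ 1) :
    4 / 9 - (2 * s + m) / 9 ≤ 1 - 2 * (4 * s / 9 - s ^ 2 / 9) - (4 / 9 - m₀ / 9) *
      Real.exp (-(2 / (4 / 9 - m₀ / 9)) * (4 * s / 9 - s ^ 2 / 9)) := by
  have h := mul_exp_neg_div_le (c := 4 / 9 - m₀ / 9) (d := 4 / 9)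
    (a := 2 * (4 * s / 9 - s ^ 2 / 9)) (by linarith) (by linarith) (by nlinarith)
  rw [show -(2 * (4 * s / 9 - s ^ 2 / 9) / (4 / 9)) = -(2 * s - s ^ 2 / 2) by ring,
    show -(2 * (4 * s / 9 - s ^ 2 / 9) / (4 / 9 - m₀ / 9)) =
      -(2 / (4 / 9 - m₀ / 9)) * (4 * s / 9 - s ^ 2 / 9) by ring] at h
  linarith [four_mul_exp_le hs0 hs1]

theorem sum_range_average_mul {n : ℕ} {μ c : ℕ → ℝ}
    (hc : ∀ i < n, c i = 4 / 9 - (2 * ∑ j ∈ Finset.range i, μ j + μ i) / 9) {k : ℕ} (hk : k ≤ n) :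
    ∑ j ∈ Finset.range k, c j * μ j =
      4 * (∑ j ∈ Finset.range k, μ j) / 9 - (∑ j ∈ Finset.range k, μ j) ^ 2 / 9 := by
  induction k with
  | zero => simp
  | succ k ih =>
    rw [Finset.sum_range_succ, Finset.sum_range_succ, ih (by omega), hc k hk]
    ring

theorem sum_Ico_average_mul {n : ℕ} {μ c : ℕ → ℝ}
    (hc : ∀ i < n, c i = 4 / 9 - (2 * ∑ j ∈ Finset.Ico (i + 1) n, μ j + μ i) / 9)
    {k : ℕ} (hk : k ≤ n) :
    ∑ j ∈ Finset.Ico k n, c j * μ j =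
      4 * (∑ j ∈ Finset.Ico k n, μ j) / 9 - (∑ j ∈ Finset.Ico k n, μ j) ^ 2 / 9 := by
  induction hk using Nat.decreasingInduction with
  | self => simp
  | of_succ k hk ih =>
    rw [Finset.sum_eq_sum_Ico_succ_bot hk, Finset.sum_eq_sum_Ico_succ_bot hk, ih, hc k hk]
    ring

theorem stmt13 (n : ℕ) (μ : ℕ → ℝ) (hμ : ∀ i < n, 0 < μ i)
    (hsum : ∑ i ∈ Finset.range n, μ i = 1) :
    let μf : ℕ → ℝ := fun i => ∑ j ∈ Finset.range i, μ j
    let μb : ℕ → ℝ := fun i => ∑ j ∈ Finset.Ico (i + 1) n, μ j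
    let cf : ℕ → ℝ := fun i => (1 / μ i) * ∫ τ in (μf i)..(μf i + μ i), psi τ
    let cb : ℕ → ℝ := fun i => (1 / μ i) * ∫ τ in (μb i)..(μb i + μ i), psi τ
    KnapsackFeasible n μ cf cb ∧ ∀ i < n, (cf i + cb i) / 2 = 1 / 3 := by
  intro μf μb cf cb
  have hcf : ∀ i < n, cf i = 4 / 9 - (2 * μf i + μ i) / 9 := fun i hi => average_psi _ _ (hμ i hi)
  have hcb : ∀ i < n, cb i = 4 / 9 - (2 * μb i + μ i) / 9 := fun i hi => average_psi _ _ (hμ i hi)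
  have hf0 : ∀ i < n, 0 ≤ μf i := fun i hi => Finset.sum_nonneg fun j hj =>
    (hμ j ((Finset.mem_range.1 hj).trans hi)).le
  have hb0 : ∀ i < n, 0 ≤ μb i := fun i _ => Finset.sum_nonneg fun j hj =>
    (hμ j (Finset.mem_Ico.1 hj).2).le
  have htotal : ∀ i < n, μf i + μ i + μb i = 1 := by
    intro i hi
    rw [← hsum, ← Finset.sum_range_add_sum_Ico μ hi, Finset.sum_range_succ]
  have hSf : ∀ i < n, ∑ j ∈ Finset.range i, cf j * μ j = 4 * μf i / 9 - μf i ^ 2 / 9 :=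
    fun i hi => sum_range_average_mul hcf hi.le
  have hSb : ∀ i < n, ∑ j ∈ Finset.Ico (i + 1) n, cb j * μ j = 4 * μb i / 9 - μb i ^ 2 / 9 :=
    fun i hi => sum_Ico_average_mul hcb hi
  have hn : 0 < n := by
    rcases Nat.eq_zero_or_pos n with rfl | h
    · simp at hsum
    · exact h
  have hlast : n - 1 < n := by omega
  have hcf0 : cf 0 = 4 / 9 - μ 0 / 9 := by
    rw [hcf 0 hn]
    simp [μf]
  have hcbl : cb (n - 1) = 4 / 9 - μ (n - 1) / 9 := by
    rw [hcb _ hlast]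
    simp [μb, Nat.sub_add_cancel hn]
  have hle1 : ∀ i < n, μ i ≤ 1 := fun i hi => by
    linarith [hf0 i hi, hb0 i hi, htotal i hi]
  refine ⟨⟨fun i hi => ?_, fun i hi => ?_, fun i hi => ?_, fun i hi => ?_, fun i hi => ?_,
    fun i hi => ?_⟩, fun i hi => ?_⟩
  · have h1 := hf0 i hi
    have h2 := hb0 i hi
    have h3 := htotal i hi
    have h4 := hμ i hi
    rw [hcf i hi, hcb i hi]
    refine ⟨⟨?_, ?_⟩, ?_, ?_⟩ <;> linarith
  · have hi' : i < n := by omega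
    have h1 : μf (i + 1) = μf i + μ i := Finset.sum_range_succ _ _
    have h2 := htotal i hi'
    have h3 := htotal (i + 1) hi
    have h4 := hμ i hi'
    have h5 := hμ (i + 1) hi
    rw [hcf i hi', hcb i hi', hcf _ hi, hcb _ hi]
    constructor <;> linarith
  · rw [hSf i hi, hcf0, hcf i hi]
    exact linear_constraint (hμ i hi).le (hμ 0 hn).le
  · rw [hSb i hi, hcbl, hcb i hi]
    exact linear_constraint (hμ i hi).le (hμ _ hlast).le
  · rw [hSf i hi, hcf0, hcf i hi]
    exact exponential_constraint (hf0 i hi)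
      (by linarith [hb0 i hi, hμ i hi, htotal i hi]) (hμ i hi).le (hμ 0 hn).le (hle1 0 hn)
  · rw [hSb i hi, hcbl, hcb i hi]
    exact exponential_constraint (hb0 i hi)
      (by linarith [hf0 i hi, hμ i hi, htotal i hi]) (hμ i hi).le (hμ _ hlast).le (hle1 _ hlast)
  · rw [hcf i hi, hcb i hi]
    linarith [htotal i hi]
end

section
/- Define ℓ : [0,1] → ℝ by ℓ(z) = 2/√5 − (1 − 1/√5)·z. Then for every z ∈ [0,1]: ℓ(z) ≥ 0, ℓ(z) + ∫₀^z ℓ(τ) dτ ≤ 1, and (ℓ(z) + ℓ(1−z))/2 = (√5 − 1)/2; in particular (ℓ(0) + ℓ(1))/2 = (√5 − 1)/2. -/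
/-- The linear function `ℓ(z) = 2/√5 − (1 − 1/√5)·z`. -/
noncomputable def ell (z : ℝ) : ℝ := 2 / Real.sqrt 5 - (1 - 1 / Real.sqrt 5) * z

theorem ell_integral (z : ℝ) :
    ∫ τ in (0:ℝ)..z, ell τ = 2 / Real.sqrt 5 * z - (1 - 1 / Real.sqrt 5) * (z ^ 2 / 2) := by
  unfold ell
  rw [intervalIntegral.integral_sub (by simp) (by apply Continuous.intervalIntegrable; fun_prop),
    intervalIntegral.integral_const_mul, integral_id, intervalIntegral.integral_const]
  simp only [smul_eq_mul]
  ring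

theorem stmt15 :
    ∀ z ∈ Set.Icc (0:ℝ) 1,
      0 ≤ ell z ∧
      ell z + (∫ τ in (0:ℝ)..z, ell τ) ≤ 1 ∧
      (ell z + ell (1 - z)) / 2 = (Real.sqrt 5 - 1) / 2 := by
  rintro z ⟨hz0, hz1⟩
  rw [ell_integral]
  unfold ell
  have hs : Real.sqrt 5 ^ 2 = 5 := Real.sq_sqrt (by norm_num)
  have hsa : Real.sqrt 5 = 5 * (1 / Real.sqrt 5) := by
    field_simp
    exact hs
  have h2 : 2 / Real.sqrt 5 = 2 * (1 / Real.sqrt 5) := by ring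
  have ha : (1 / Real.sqrt 5) ^ 2 = 1 / 5 := by rw [div_pow, hs, one_pow]
  have ha0 : 0 < 1 / Real.sqrt 5 := by positivity
  rw [h2]
  generalize 1 / Real.sqrt 5 = a at *
  have ha1 : a < 1 := by nlinarith
  have ha3 : 1 < 3 * a := by nlinarith
  refine ⟨by nlinarith, ?_, by rw [hsa]; ring⟩
  have hsq : (1 - a) * (1 - (2 * a - (1 - a) * z + (2 * a * z - (1 - a) * (z ^ 2 / 2)))) =
      ((1 - a) * z - (3 * a - 1)) ^ 2 / 2 := by
    linear_combination (-5 / 2) * ha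
  have hsq_nonneg : 0 ≤ ((1 - a) * z - (3 * a - 1)) ^ 2 / 2 := by positivity
  rw [← hsq, mul_nonneg_iff_of_pos_left (sub_pos.mpr ha1)] at hsq_nonneg
  linarith
end
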